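/- arXiv:1601.04924 — 2 statements merged into one kernel-verified Lean document; each statement's English description precedes it below -/
import Mathlib

section
/- Let (V₀, ω₀), (V₁, ω₁), (V₂, ω₂) be symplectic vector spaces. Let L₁ ⊆ V₀ × V₁ be a Lagrangian subspace for the form Ω₀₁((u₀,u₁),(v₀,v₁)) = ω₁(u₁,v₁) − ω₀(u₀,v₀), and let L₂ ⊆ V₁ × V₂ be a Lagrangian subspace for the analogous form Ω₁₂. Assume the transversality condition: for every v ∈ V₁ there exist (x₀,x₁) ∈ L₁ and (y₁,y₂) ∈ L₂ with x₁ − y₁ = v. Then the geometric composition L₁ ∘ L₂ := {(v₀, v₂) ∈ V₀ × V₂ : ∃ v₁ ∈ V₁, (v₀,v₁) ∈ L₁ and (v₁,v₂) ∈ L₂} is a Lagrangian subspace of V₀ × V₂ for the form Ω₀₂((u₀,u₂),(v₀,v₂)) = ω₂(u₂,v₂) − ω₀(u₀,v₀). -/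
/-- A subspace `L` is Lagrangian for a pairing `Ω` if it equals its own
`Ω`-orthogonal complement. -/
def IsLagrangian {V : Type*} [AddCommGroup V] [Module ℝ V]
    (Ω : V → V → ℝ) (L : Submodule ℝ V) : Prop :=
  ∀ v : V, v ∈ L ↔ ∀ w ∈ L, Ω v w = 0

/-- Transverse geometric composition of linear Lagrangian correspondences between
symplectic vector spaces is again a Lagrangian correspondence. -/
theorem geometric_composition_lagrangian
    {V₀ V₁ V₂ : Type*}
    [AddCommGroup V₀] [Module ℝ V₀] [FiniteDimensional ℝ V₀]
    [AddCommGroup V₁] [Module ℝ V₁] [FiniteDimensional ℝ V₁]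
    [AddCommGroup V₂] [Module ℝ V₂] [FiniteDimensional ℝ V₂]
    (ω₀ : V₀ →ₗ[ℝ] V₀ →ₗ[ℝ] ℝ) (ω₁ : V₁ →ₗ[ℝ] V₁ →ₗ[ℝ] ℝ) (ω₂ : V₂ →ₗ[ℝ] V₂ →ₗ[ℝ] ℝ)
    (halt₀ : ∀ v : V₀, ω₀ v v = 0) (hnd₀ : ∀ v : V₀, (∀ w : V₀, ω₀ v w = 0) → v = 0)
    (halt₁ : ∀ v : V₁, ω₁ v v = 0) (hnd₁ : ∀ v : V₁, (∀ w : V₁, ω₁ v w = 0) → v = 0)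
    (halt₂ : ∀ v : V₂, ω₂ v v = 0) (hnd₂ : ∀ v : V₂, (∀ w : V₂, ω₂ v w = 0) → v = 0)
    (L₁ : Submodule ℝ (V₀ × V₁)) (L₂ : Submodule ℝ (V₁ × V₂))
    (hL₁ : IsLagrangian (fun u v => ω₁ u.2 v.2 - ω₀ u.1 v.1) L₁)
    (hL₂ : IsLagrangian (fun u v => ω₂ u.2 v.2 - ω₁ u.1 v.1) L₂)
    (htrans : ∀ v : V₁, ∃ x ∈ L₁, ∃ y ∈ L₂, x.2 - y.1 = v) :
    ∃ L : Submodule ℝ (V₀ × V₂),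
      (L : Set (V₀ × V₂)) = {p : V₀ × V₂ | ∃ v₁ : V₁, (p.1, v₁) ∈ L₁ ∧ (v₁, p.2) ∈ L₂} ∧
      IsLagrangian (fun u v => ω₂ u.2 v.2 - ω₀ u.1 v.1) L := by
  let L : Submodule ℝ (V₀ × V₂) :=
    { carrier := {p : V₀ × V₂ | ∃ v₁ : V₁, (p.1, v₁) ∈ L₁ ∧ (v₁, p.2) ∈ L₂}
      add_mem' := by
        rintro p q ⟨v, h1, h2⟩ ⟨w, h3, h4⟩
        exact ⟨v + w, L₁.add_mem h1 h3, L₂.add_mem h2 h4⟩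
      zero_mem' := ⟨0, L₁.zero_mem, L₂.zero_mem⟩
      smul_mem' := by
        rintro c p ⟨v, h1, h2⟩
        exact ⟨c • v, L₁.smul_mem c h1, L₂.smul_mem c h2⟩ }
  refine ⟨L, rfl, ?_⟩
  rintro ⟨a, c⟩
  constructor
  · rintro ⟨v, h1, h2⟩ ⟨p, q⟩ ⟨w, h3, h4⟩
    have e1 := (hL₁ _).1 h1 _ h3
    have e2 := (hL₂ _).1 h2 _ h4
    dsimp only at e1 e2 ⊢
    linarith
  · intro h
    let d : (L₁ × L₂) →ₗ[ℝ] V₁ :=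
      (LinearMap.snd ℝ V₀ V₁ ∘ₗ L₁.subtype) ∘ₗ LinearMap.fst ℝ L₁ L₂
        - (LinearMap.fst ℝ V₁ V₂ ∘ₗ L₂.subtype) ∘ₗ LinearMap.snd ℝ L₁ L₂
    let f : (L₁ × L₂) →ₗ[ℝ] ℝ :=
      (ω₂ c ∘ₗ LinearMap.snd ℝ V₁ V₂ ∘ₗ L₂.subtype) ∘ₗ LinearMap.snd ℝ L₁ L₂
        - (ω₀ a ∘ₗ LinearMap.fst ℝ V₀ V₁ ∘ₗ L₁.subtype) ∘ₗ LinearMap.fst ℝ L₁ L₂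
    have hd : ∀ x y, d (x, y) = x.1.2 - y.1.1 := fun x y => rfl
    have hf : ∀ x y, f (x, y) = ω₂ c y.1.2 - ω₀ a x.1.1 := fun x y => rfl
    have hker : ∀ z, d z = 0 → f z = 0 := by
      rintro ⟨⟨⟨x0, x1⟩, hx⟩, ⟨⟨y1, y2⟩, hy⟩⟩ hz
      rw [hd] at hz
      have hxy : x1 = y1 := sub_eq_zero.1 hz
      subst hxy
      exact h (x0, y2) ⟨x1, hx, hy⟩
    have hsurj : Function.Surjective d := by
      intro v
      obtain ⟨x, hx, y, hy, e⟩ := htrans v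
      exact ⟨(⟨x, hx⟩, ⟨y, hy⟩), e⟩
    obtain ⟨s, hs⟩ := d.exists_rightInverse_of_surjective (LinearMap.range_eq_top.2 hsurj)
    have hs' : ∀ v, d (s v) = v := fun v => LinearMap.congr_fun hs v
    have hfs : ∀ z, f z = f (s (d z)) := by
      intro z
      have := hker (z - s (d z)) (by rw [map_sub, hs', sub_self])
      rwa [map_sub, sub_eq_zero] at this
    have hinj : Function.Injective ω₁ := by
      rw [injective_iff_map_eq_zero]
      intro v hv
      exact hnd₁ v fun w => by rw [hv]; rfl
    have hωs : Function.Surjective ω₁ :=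
      (LinearMap.injective_iff_surjective_of_finrank_eq_finrank
        (Subspace.dual_finrank_eq (K := ℝ) (V := V₁)).symm).1 hinj
    obtain ⟨b, hb⟩ := hωs (-(f ∘ₗ s))
    have key : ∀ z, f z = - ω₁ b (d z) := by
      intro z
      rw [hb, hfs z]
      simp
    refine ⟨b, (hL₁ _).2 ?_, (hL₂ _).2 ?_⟩
    · intro w hw
      have := key (⟨w, hw⟩, 0)
      rw [hf, hd] at this
      simp at this
      dsimp only
      linarith
    · intro w hw
      have := key (0, ⟨w, hw⟩)
      rw [hf, hd] at this
      simp at this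
      dsimp only
      linarith
end

section
/- Let r ≥ 1 and d be coprime integers and set ζ = exp(2πi d/r). If (a, b) and (a', b') are two pairs of r × r special unitary matrices (unitary with determinant 1) satisfying a·b·a⁻¹·b⁻¹ = ζ·I and a'·b'·a'⁻¹·b'⁻¹ = ζ·I, then there exists an r × r unitary matrix g with g·a·g⁻¹ = a' and g·b·g⁻¹ = b'. In other words, for coprime r and d all such pairs are simultaneously unitarily conjugate. -/
open Matrix in
/-- The weighted cyclic shift matrix. -/
def shiftC (n : ℕ) (μ : ℂ) : Matrix (Fin (n+1)) (Fin (n+1)) ℂ :=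
  fun k l => if k = l + 1 then (if l = Fin.last n then μ else 1) else 0

lemma shiftC_det (n : ℕ) (μ : ℂ) : (shiftC n μ).det = (shiftC n 1).det * μ := by
  have h : shiftC n μ = shiftC n 1 *
      Matrix.diagonal (fun l => if l = Fin.last n then μ else 1) := by
    ext k l
    rw [Matrix.mul_diagonal]
    simp only [shiftC]
    split_ifs <;> simp
  rw [h, Matrix.det_mul, Matrix.det_diagonal]
  simp

open scoped ComplexOrder in
lemma exists_unit_eigenvector (n : ℕ) (a : Matrix (Fin (n+1)) (Fin (n+1)) ℂ) :
    ∃ (lam : ℂ) (v : Fin (n+1) → ℂ), star v ⬝ᵥ v = 1 ∧ a.mulVec v = lam • v := by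
  obtain ⟨lam, hl⟩ := Module.End.exists_eigenvalue (Matrix.toLin' a)
  obtain ⟨v, hv⟩ := hl.exists_hasEigenvector
  have hav : a.mulVec v = lam • v := by simpa using hv.apply_eq_smul
  have hpos : 0 < star v ⬝ᵥ v := Matrix.dotProduct_star_self_pos_iff.2 hv.2
  obtain ⟨h1, h2⟩ := Complex.lt_def.1 hpos
  set s := star v ⬝ᵥ v with hs
  have hse : s = ((s.re : ℝ) : ℂ) := by
    apply Complex.ext <;> simp
    simpa using h2.symm
  have h1' : 0 < s.re := by simpa using h1
  refine ⟨lam, ((Real.sqrt s.re)⁻¹ : ℂ) • v, ?_, ?_⟩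
  · rw [star_smul, smul_dotProduct, dotProduct_smul, ← hs, smul_eq_mul, smul_eq_mul, hse]
    simp only [Complex.ofReal_re]
    rw [← Complex.ofReal_inv, Complex.star_def, Complex.conj_ofReal]
    norm_cast
    have h3 := Real.mul_self_sqrt h1'.le
    have h4 : Real.sqrt s.re ≠ 0 := (Real.sqrt_pos.2 h1').ne'
    field_simp
    rw [sq, h3]
  · rw [Matrix.mulVec_smul, hav, smul_comm]

lemma pow_comm_rel (n : ℕ) (ζ : ℂ) (a b : Matrix (Fin (n+1)) (Fin (n+1)) ℂ)
    (hab : a * b = ζ • (b * a)) (k : ℕ) : a * b ^ k = ζ ^ k • (b ^ k * a) := by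
  induction k with
  | zero => simp
  | succ k ih =>
    rw [pow_succ, ← mul_assoc, ih, smul_mul_assoc, mul_assoc, hab, mul_smul_comm, smul_smul,
      ← mul_assoc, pow_succ]

lemma pow_eigen (n : ℕ) (ζ : ℂ) (a b : Matrix (Fin (n+1)) (Fin (n+1)) ℂ)
    (hab : a * b = ζ • (b * a)) (lam : ℂ) (v : Fin (n+1) → ℂ)
    (hv : a.mulVec v = lam • v) (k : ℕ) :
    a.mulVec ((b ^ k).mulVec v) = (lam * ζ ^ k) • (b ^ k).mulVec v := by
  rw [Matrix.mulVec_mulVec, pow_comm_rel n ζ a b hab, Matrix.smul_mulVec, ← Matrix.mulVec_mulVec,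
    hv, Matrix.mulVec_smul, smul_smul, mul_comm]

lemma unitary_norm (n : ℕ) (b : Matrix (Fin (n+1)) (Fin (n+1)) ℂ)
    (hb : b ∈ Matrix.unitaryGroup (Fin (n+1)) ℂ) (v : Fin (n+1) → ℂ)
    (hv : star v ⬝ᵥ v = 1) : star (b.mulVec v) ⬝ᵥ b.mulVec v = 1 := by
  rw [Matrix.star_mulVec, ← Matrix.dotProduct_mulVec, Matrix.mulVec_mulVec]
  have := Matrix.mem_unitaryGroup_iff'.1 hb
  rw [Matrix.star_eq_conjTranspose] at this
  rw [this, Matrix.one_mulVec, hv]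

open Matrix in
lemma core (n : ℕ) (ζ : ℂ) (hζ : IsPrimitiveRoot ζ (n+1))
    (a b : Matrix (Fin (n+1)) (Fin (n+1)) ℂ)
    (ha : a ∈ Matrix.unitaryGroup (Fin (n+1)) ℂ) (hb : b ∈ Matrix.unitaryGroup (Fin (n+1)) ℂ)
    (hab : a * b = ζ • (b * a)) (lam : ℂ) (v : Fin (n+1) → ℂ) (hv1 : star v ⬝ᵥ v = 1)
    (hv : a.mulVec v = lam • v) :
    ∃ P ∈ Matrix.unitaryGroup (Fin (n+1)) ℂ, ∃ μ : ℂ,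
      a * P = P * Matrix.diagonal (fun k : Fin (n+1) => lam * ζ ^ (k : ℕ)) ∧
      b * P = P * shiftC n μ := by
  set D : Fin (n+1) → ℂ := fun k => lam * ζ ^ (k : ℕ) with hD
  let P : Matrix (Fin (n+1)) (Fin (n+1)) ℂ := Matrix.of fun i k => ((b ^ (k : ℕ)).mulVec v) i
  have haP : a * P = P * Matrix.diagonal D := by
    ext i k
    rw [Matrix.mul_diagonal]
    have := congrFun (pow_eigen n ζ a b hab lam v hv k) i
    simp only [Pi.smul_apply, smul_eq_mul] at this
    rw [mul_comm (P i k)]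
    exact this
  have haa : aᴴ * a = 1 := Matrix.mem_unitaryGroup_iff'.1 ha
  have hG : (Matrix.diagonal D)ᴴ * (Pᴴ * P) * Matrix.diagonal D = Pᴴ * P := by
    calc _ = (P * Matrix.diagonal D)ᴴ * (P * Matrix.diagonal D) := by
            rw [conjTranspose_mul]; simp only [Matrix.mul_assoc]
      _ = Pᴴ * (aᴴ * a) * P := by
            rw [← haP, conjTranspose_mul]; simp only [Matrix.mul_assoc]
      _ = _ := by rw [haa, Matrix.mul_one]
  have hGe : ∀ k l, star (D k) * (Pᴴ * P) k l * D l = (Pᴴ * P) k l := by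
    intro k l
    have := congrFun (congrFun hG k) l
    rwa [Matrix.mul_diagonal, Matrix.diagonal_conjTranspose, Matrix.diagonal_mul] at this
  have hGd : ∀ k, (Pᴴ * P) k k = 1 := by
    intro k
    exact unitary_norm n (b ^ (k : ℕ)) (pow_mem hb _) v hv1
  have hDD : ∀ k, star (D k) * D k = 1 := by
    intro k
    have := hGe k k
    rwa [hGd, mul_one] at this
  have hl0 : lam ≠ 0 := by
    rintro rfl
    have := hDD 0
    simp [hD] at this
  have hP1 : Pᴴ * P = 1 := by
    ext k l
    by_cases hkl : k = l
    · subst hkl; rw [hGd, Matrix.one_apply_eq]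
    · rw [Matrix.one_apply_ne hkl]
      by_contra hne
      apply hkl
      have h1 : star (D k) * D l = 1 := by
        apply mul_right_cancel₀ hne
        rw [one_mul]
        nth_rewrite 2 [← hGe k l]
        ring
      have h2 : star (D k) ≠ 0 := left_ne_zero_of_mul_eq_one h1
      have h3 : D k = D l := mul_left_cancel₀ h2 ((hDD k).trans h1.symm)
      have h4 : ζ ^ (k : ℕ) = ζ ^ (l : ℕ) := mul_left_cancel₀ hl0 h3
      exact Fin.ext (hζ.pow_inj k.2 l.2 h4)
  have hP2 : P * Pᴴ = 1 := mul_eq_one_comm.1 hP1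
  set M := Pᴴ * (b * P) with hM
  have hbP : b * P = P * M := by rw [hM, ← Matrix.mul_assoc, hP2, Matrix.one_mul]
  have hDM : Matrix.diagonal D * M = ζ • (M * Matrix.diagonal D) := by
    have h1 : P * (Matrix.diagonal D * M) = P * (ζ • (M * Matrix.diagonal D)) := by
      calc _ = a * b * P := by
              rw [← Matrix.mul_assoc, ← haP, Matrix.mul_assoc, ← hbP, Matrix.mul_assoc]
        _ = ζ • (b * (a * P)) := by rw [hab, smul_mul_assoc, Matrix.mul_assoc]
        _ = _ := by rw [haP, ← Matrix.mul_assoc, hbP, mul_smul_comm, Matrix.mul_assoc]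
    have := congrArg (fun X => Pᴴ * X) h1
    simpa only [← Matrix.mul_assoc, hP1, Matrix.one_mul, mul_smul_comm] using this
  refine ⟨P, Matrix.mem_unitaryGroup_iff'.2 hP1, M 0 (Fin.last n), haP, ?_⟩
  rw [hbP]
  congr 1
  ext k l
  simp only [shiftC]
  by_cases hl : l = Fin.last n
  · subst hl
    by_cases hk : k = 0
    · subst hk; simp
    · have hk' : ¬ (k = Fin.last n + 1) := by simpa using hk
      rw [if_neg hk']
      by_contra hne
      have h := congrFun (congrFun hDM k) (Fin.last n)
      rw [Matrix.diagonal_mul, Matrix.smul_apply, Matrix.mul_diagonal, smul_eq_mul] at h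
      have h2 : lam * M k (Fin.last n) ≠ 0 := mul_ne_zero hl0 hne
      have h3 : ζ ^ (k : ℕ) = 1 := by
        apply mul_left_cancel₀ h2
        have h5 := hζ.pow_eq_one
        rw [pow_succ] at h5
        simp only [hD, Fin.val_last] at h
        linear_combination h + M k (Fin.last n) * lam * h5
      apply hk
      exact Fin.ext (hζ.pow_inj k.2 (Nat.succ_pos n) (by simpa using h3))
  · have hcol : ∀ i, (b * P) i l = P i (l + 1) := by
      intro i
      have hlv : ((l + 1 : Fin (n+1)) : ℕ) = l + 1 := by
        rw [Fin.val_add_one, if_neg hl]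
      change (b.mulVec ((b ^ (l : ℕ)).mulVec v)) i = ((b ^ ((l+1 : Fin (n+1)) : ℕ)).mulVec v) i
      rw [hlv, Matrix.mulVec_mulVec, pow_succ']
    have : M k l = (Pᴴ * P) k (l + 1) := by
      rw [hM, Matrix.mul_apply, Matrix.mul_apply]
      simp only [hcol]
    rw [this, hP1, if_neg hl, Matrix.one_apply]

lemma comm_of_commutator (n : ℕ) (ζ : ℂ) (a b : Matrix (Fin (n+1)) (Fin (n+1)) ℂ)
    (ha : a.det = 1) (hb : b.det = 1)
    (hab : a * b * a⁻¹ * b⁻¹ = ζ • (1 : Matrix (Fin (n+1)) (Fin (n+1)) ℂ)) :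
    a * b = ζ • (b * a) := by
  have ha' : IsUnit a.det := by simp [ha]
  have hb' : IsUnit b.det := by simp [hb]
  have := congrArg (fun X => X * b * a) hab
  simp only [smul_mul_assoc, Matrix.one_mul] at this
  rwa [Matrix.nonsing_inv_mul_cancel_right _ _ hb', Matrix.nonsing_inv_mul_cancel_right _ _ ha']
    at this

lemma det_of_conj (n : ℕ) (a P X : Matrix (Fin (n+1)) (Fin (n+1)) ℂ)
    (hP : P ∈ Matrix.unitaryGroup (Fin (n+1)) ℂ) (ha : a.det = 1) (h : a * P = P * X) :
    X.det = 1 := by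
  have h1 := congrArg Matrix.det (Matrix.mem_unitaryGroup_iff'.1 hP)
  rw [Matrix.det_mul, Matrix.det_one] at h1
  have h2 := congrArg Matrix.det h
  rw [Matrix.det_mul, Matrix.det_mul, ha, one_mul] at h2
  exact (mul_left_cancel₀ (right_ne_zero_of_mul_eq_one h1) (by rw [mul_one]; exact h2)).symm

/-- For coprime `r ≥ 1` and `d`, any two pairs of special unitary `r × r` matrices
whose commutators equal the central element `ζ·I`, `ζ = exp(2πi d/r)`, are
simultaneously conjugate by a unitary matrix. -/
theorem commutator_pairs_unitarily_conjugate (r : ℕ) (hr : 1 ≤ r) (d : ℤ)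
    (hrd : IsCoprime (r : ℤ) d)
    (a b a' b' : Matrix (Fin r) (Fin r) ℂ)
    (ha : a ∈ Matrix.unitaryGroup (Fin r) ℂ) (hb : b ∈ Matrix.unitaryGroup (Fin r) ℂ)
    (ha' : a' ∈ Matrix.unitaryGroup (Fin r) ℂ) (hb' : b' ∈ Matrix.unitaryGroup (Fin r) ℂ)
    (hdeta : a.det = 1) (hdetb : b.det = 1) (hdeta' : a'.det = 1) (hdetb' : b'.det = 1)
    (hab : a * b * a⁻¹ * b⁻¹ =
      Complex.exp (2 * (Real.pi : ℂ) * Complex.I * (d : ℂ) / (r : ℂ)) •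
        (1 : Matrix (Fin r) (Fin r) ℂ))
    (hab' : a' * b' * a'⁻¹ * b'⁻¹ =
      Complex.exp (2 * (Real.pi : ℂ) * Complex.I * (d : ℂ) / (r : ℂ)) •
        (1 : Matrix (Fin r) (Fin r) ℂ)) :
    ∃ g : Matrix (Fin r) (Fin r) ℂ, g ∈ Matrix.unitaryGroup (Fin r) ℂ ∧
      g * a * g⁻¹ = a' ∧ g * b * g⁻¹ = b' := by
  obtain ⟨n, rfl⟩ : ∃ n, r = n + 1 := ⟨r - 1, by omega⟩
  set ζ := Complex.exp (2 * (Real.pi : ℂ) * Complex.I * (d : ℂ) / ((n + 1 : ℕ) : ℂ)) with hζd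
  have hζ : IsPrimitiveRoot ζ (n+1) := by
    have h0 := Complex.isPrimitiveRoot_exp (n+1) (Nat.succ_ne_zero n)
    have h1 := h0.zpow_of_gcd_eq_one d (Int.isCoprime_iff_gcd_eq_one.1 hrd.symm)
    rw [← Complex.exp_int_mul] at h1
    have h2 : (d : ℂ) * (2 * (Real.pi : ℂ) * Complex.I / ((n + 1 : ℕ) : ℂ)) =
        2 * (Real.pi : ℂ) * Complex.I * (d : ℂ) / ((n + 1 : ℕ) : ℂ) := by ring
    rw [h2] at h1
    exact h1
  have hc := comm_of_commutator n ζ a b hdeta hdetb hab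
  have hc' := comm_of_commutator n ζ a' b' hdeta' hdetb' hab'
  obtain ⟨lam, v, hv1, hv⟩ := exists_unit_eigenvector n a
  obtain ⟨lam', v', hv1', hv'⟩ := exists_unit_eigenvector n a'
  obtain ⟨P, hP, μ, hPa, hPb⟩ := core n ζ hζ a b ha hb hc lam v hv1 hv
  obtain ⟨P₁, hP₁, μ₁, hPa₁, hPb₁⟩ := core n ζ hζ a' b' ha' hb' hc' lam' v' hv1' hv'
  have hd := det_of_conj n a P _ hP hdeta hPa
  have hd₁ := det_of_conj n a' P₁ _ hP₁ hdeta' hPa₁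
  rw [Matrix.det_diagonal, Finset.prod_mul_distrib, Finset.prod_const, Finset.card_univ,
    Fintype.card_fin] at hd hd₁
  have hpow : lam ^ (n+1) = lam' ^ (n+1) :=
    mul_right_cancel₀ (right_ne_zero_of_mul_eq_one hd) (hd.trans hd₁.symm)
  have hl0 : lam' ≠ 0 := by
    rintro rfl
    simp at hd₁
  obtain ⟨j, -, hj⟩ := hζ.eq_pow_of_pow_eq_one (ξ := lam / lam') (by
    rw [div_pow, hpow, div_self (pow_ne_zero _ hl0)])
  have hlj : lam' * ζ ^ j = lam := by rw [hj]; field_simp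
  have hv2 := pow_eigen n ζ a' b' hc' lam' v' hv' j
  rw [hlj] at hv2
  obtain ⟨Q, hQ, ν, hQa, hQb⟩ := core n ζ hζ a' b' ha' hb' hc' lam _
    (unitary_norm n (b' ^ j) (pow_mem hb' j) v' hv1') hv2
  have he := det_of_conj n b P _ hP hdetb hPb
  have he' := det_of_conj n b' Q _ hQ hdetb' hQb
  rw [shiftC_det] at he he'
  have hμ : μ = ν := mul_left_cancel₀ (left_ne_zero_of_mul_eq_one he) (he.trans he'.symm)
  subst hμ
  have hP1 : star P * P = 1 := Matrix.mem_unitaryGroup_iff'.1 hP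
  have hP2 : P * star P = 1 := Matrix.mem_unitaryGroup_iff.1 hP
  have hQ2 : Q * star Q = 1 := Matrix.mem_unitaryGroup_iff.1 hQ
  have hg : Q * star P ∈ Matrix.unitaryGroup (Fin (n+1)) ℂ := mul_mem hQ (Unitary.star_mem hP)
  have hinv : (Q * star P)⁻¹ = P * star Q := by
    rw [Matrix.inv_eq_left_inv (B := P * star Q)]
    have := Matrix.mem_unitaryGroup_iff'.1 hg
    simpa using this
  have key : ∀ x y X : Matrix (Fin (n+1)) (Fin (n+1)) ℂ, x * P = P * X → y * Q = Q * X →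
      (Q * star P) * x * (Q * star P)⁻¹ = y := by
    intro x y X hx hy
    rw [hinv]
    calc _ = Q * star P * (x * P) * star Q := by simp only [Matrix.mul_assoc]
      _ = Q * (star P * P) * X * star Q := by rw [hx]; simp only [Matrix.mul_assoc]
      _ = y * (Q * star Q) := by rw [hP1, Matrix.mul_one, ← hy, Matrix.mul_assoc]
      _ = y := by rw [hQ2, Matrix.mul_one]
  exact ⟨Q * star P, hg, key a a' _ hPa hQa, key b b' _ hPb hQb⟩
end
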